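/- Let X be a generic m × n matrix over a field k graded with deg(x_{ij}) = p for columns j ≤ a and deg(x_{ij}) = q > p otherwise. Fix t and d, and set r = ⌈(tq−d)/(q−p)⌉. Then the ideal I_t(X)_{≤d} generated by the t-minors of X of degree ≤ d equals I_t(X) ∩ I_r(A), where A is the submatrix of the first a columns. -/

import Mathlib

noncomputable section

/-- The generic `m × n` matrix over `k`. -/
def genMat (k : Type*) [CommRing k] (m n : ℕ) :
    Matrix (Fin m) (Fin n) (MvPolynomial (Fin m × Fin n) k) :=
  fun i j => MvPolynomial.X (i, j)

/-- The weight giving `deg x_{ij} = p` for the first `a` columns, `q` otherwise. -/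
def wt (m n a p q : ℕ) : Fin m × Fin n → ℕ :=
  fun x => if (x.2 : ℕ) < a then p else q

/-- Increasing sequences of `m` column indices, ordered componentwise. -/
abbrev ColSeq (m N : ℕ) := {c : Fin m → Fin N // StrictMono c}

/-- The maximal minor (up to sign) of `M` on the columns `c`. -/
def bracket {S : Type*} [CommRing S] {m N : ℕ} (M : Matrix (Fin m) (Fin N) S)
    (c : Fin m → Fin N) : S :=
  (M.submatrix id c).det

section Bracket

variable {S : Type*} [CommRing S] {m N : ℕ} (M : Matrix (Fin m) (Fin N) S)

lemma exists_perm_strictMono {c : Fin m → Fin N} (hc : Function.Injective c) :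
    ∃ τ : Equiv.Perm (Fin m), StrictMono (c ∘ τ) :=
  ⟨Tuple.sort c, (Tuple.monotone_sort c).strictMono_of_injective
    (hc.comp (Equiv.injective _))⟩

lemma bracket_comp_perm (c : Fin m → Fin N) (τ : Equiv.Perm (Fin m)) :
    bracket M (c ∘ τ) = (Equiv.Perm.sign τ : ℤ) • bracket M c := by
  have := Matrix.det_permute' τ (M.submatrix id c)
  rw [zsmul_eq_mul]
  exact this

lemma bracket_eq_zero_of_not_injective {c : Fin m → Fin N} (hc : ¬ Function.Injective c) :
    bracket M c = 0 := by
  simp only [Function.Injective, not_forall] at hc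
  obtain ⟨i, j, h, hij⟩ := hc
  exact Matrix.det_zero_of_column_eq hij fun l => by simp [h]

lemma bracket_eq_zero_or_sorted (c : Fin m → Fin N) :
    bracket M c = 0 ∨ ∃ (c' : ColSeq m N) (τ : Equiv.Perm (Fin m)), c'.1 = c ∘ τ ∧
      (bracket M c = bracket M c'.1 ∨ bracket M c = - bracket M c'.1) := by
  by_cases hc : Function.Injective c
  · right
    obtain ⟨τ, hτ⟩ := exists_perm_strictMono hc
    refine ⟨⟨_, hτ⟩, τ, rfl, ?_⟩
    simp only [bracket_comp_perm]
    rcases Int.units_eq_one_or (Equiv.Perm.sign τ) with h | h <;> simp [h]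
  · exact Or.inl (bracket_eq_zero_of_not_injective M hc)

lemma card_filter_comp_perm (c : Fin m → Fin N) (τ : Equiv.Perm (Fin m)) (p : Fin N → Prop)
    [DecidablePred p] :
    (Finset.univ.filter fun s => p ((c ∘ τ) s)).card = (Finset.univ.filter fun s => p (c s)).card :=
  Finset.card_bij' (fun s _ => τ s) (fun s _ => τ.symm s) (by simp) (by simp) (by simp) (by simp)

lemma ColSeq.le_of_card_le (c a : ColSeq m N)
    (h : ∀ x, (Finset.univ.filter fun s => x ≤ c.1 s).card ≤
      (Finset.univ.filter fun s => x ≤ a.1 s).card) : c ≤ a := by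
  intro j
  by_contra! hj
  have h1 : (Finset.Ici j).card ≤ (Finset.univ.filter fun s => c.1 j ≤ c.1 s).card :=
    Finset.card_le_card fun s hs => by
      simpa using c.2.monotone (Finset.mem_Ici.1 hs)
  have h2 : (Finset.univ.filter fun s => c.1 j ≤ a.1 s).card ≤ (Finset.Ioi j).card :=
    Finset.card_le_card fun s hs => by
      simp only [Finset.mem_filter, Finset.mem_univ, true_and] at hs
      exact Finset.mem_Ioi.2 (a.2.lt_iff_lt.1 (hj.trans_le hs))
  have h3 : (Finset.Ioi j).card < (Finset.Ici j).card :=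
    by
    rw [Fin.card_Ioi, Fin.card_Ici]
    omega
  have := h (c.1 j)
  omega

/-- An alternating map with the arguments outside `P` fixed. -/
def AlternatingMap.fixArgs {R A B ι : Type*} [CommRing R] [AddCommGroup A] [Module R A]
    [AddCommGroup B] [Module R B] (f : A [⋀^ι]→ₗ[R] B) (P : ι → Prop)
    [DecidablePred P] (u : ι → A) : A [⋀^{i // P i}]→ₗ[R] B :=
  { f.toMultilinearMap.domDomRestrict P (fun i => u i) with
    map_eq_zero_of_eq' := fun v i j h hij => by
      refine f.map_eq_zero_of_eq (i := i.1) (j := j.1) _ ?_ (fun e => hij (Subtype.ext e))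
      simp [i.2, j.2, h] }

lemma AlternatingMap.fixArgs_apply {R A B ι : Type*} [CommRing R] [AddCommGroup A] [Module R A]
    [AddCommGroup B] [Module R B] (f : A [⋀^ι]→ₗ[R] B) (P : ι → Prop)
    [DecidablePred P] (u : ι → A) (v : {i // P i} → A) :
    f.fixArgs P u v = f (fun i => if h : P i then v ⟨i, h⟩ else u i) := rfl

lemma AlternatingMap.eq_zero_of_card_lt {B ι : Type*} [Fintype ι] [AddCommGroup B] [Module S B]
    (h : m < Fintype.card ι) (f : (Fin m → S) [⋀^ι]→ₗ[S] B) : f = 0 := by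
  refine Module.Basis.ext_alternating (Pi.basisFun S (Fin m)) fun v hv => ?_
  have := Fintype.card_le_of_injective v hv
  simp at this
  omega

lemma bracket_eq_detRowAlternating (c : Fin m → Fin N) :
    bracket M c = Matrix.detRowAlternating fun i => M.transpose (c i) := by
  rw [bracket, ← Matrix.det_transpose]
  rfl

/-- The two index blocks entering the exchange relation at position `i`. -/
abbrev ExchangeIndex {m : ℕ} (i : Fin m) := {s : Fin m // i ≤ s} ⊕ {s : Fin m // s ≤ i}

/-- The columns of the exchange relation: the tail of `a` and the head of `b`. -/
def exchangeCols (a b : Fin m → Fin N) (i : Fin m) : ExchangeIndex i → Fin N :=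
  Sum.elim (fun s => a s) (fun s => b s)

def exchangeLeft (a b : Fin m → Fin N) (i : Fin m) (σ : Equiv.Perm (ExchangeIndex i)) :
    Fin m → Fin N :=
  fun s => if h : i ≤ s then exchangeCols a b i (σ (Sum.inl ⟨s, h⟩)) else a s

def exchangeRight (a b : Fin m → Fin N) (i : Fin m) (σ : Equiv.Perm (ExchangeIndex i)) :
    Fin m → Fin N :=
  fun s => if h : s ≤ i then exchangeCols a b i (σ (Sum.inr ⟨s, h⟩)) else b s

/-- The exchange relation among products of two brackets, as a statement on subgroups: the sum of
the shuffles is alternating in `m + 1` vectors of a free module of rank `m`. -/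
lemma bracket_mul_bracket_mem (a b : Fin m → Fin N) (i : Fin m) (W : AddSubgroup S)
    (hW : ∀ σ : Equiv.Perm (ExchangeIndex i), (∃ s s', σ (Sum.inl s) = Sum.inr s') →
      bracket M (exchangeLeft a b i σ) * bracket M (exchangeRight a b i σ) ∈ W) :
    bracket M a * bracket M b ∈ W := by
  classical
  let F₁ := (Matrix.detRowAlternating (n := Fin m) (R := S)).fixArgs (fun s => i ≤ s)
    (fun s => M.transpose (a s))
  let F₂ := (Matrix.detRowAlternating (n := Fin m) (R := S)).fixArgs (fun s => s ≤ i)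
    (fun s => M.transpose (b s))
  let z : ExchangeIndex i → (Fin m → S) := fun p => M.transpose (exchangeCols a b i p)
  have hcard : m < Fintype.card (ExchangeIndex i) := by
    rw [Fintype.card_sum, Fintype.card_subtype, Fintype.card_subtype]
    have h1 : (Finset.univ.filter fun s => i ≤ s) = Finset.Ici i := by ext; simp
    have h2 : (Finset.univ.filter fun s => s ≤ i) = Finset.Iic i := by ext; simp
    rw [h1, h2, Fin.card_Ici, Fin.card_Iic]
    omega
  have hterm : ∀ σ : Equiv.Perm (ExchangeIndex i),
      LinearMap.mul' S S (AlternatingMap.domCoprod.summand F₁ F₂ (Quotient.mk'' σ) z) =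
      (Equiv.Perm.sign σ : ℤ) •
        (bracket M (exchangeLeft a b i σ) * bracket M (exchangeRight a b i σ)) := by
    intro σ
    rw [AlternatingMap.domCoprod.summand_mk'', smul_apply,
      MultilinearMap.domDomCongr_apply, MultilinearMap.domCoprod_apply, Units.smul_def, map_zsmul,
      LinearMap.mul'_apply, bracket_eq_detRowAlternating, bracket_eq_detRowAlternating]
    congr 2
    · refine (AlternatingMap.fixArgs_apply _ _ _ _).trans (congrArg _ (funext fun s => ?_))
      by_cases h : i ≤ s <;> simp [h, exchangeLeft, z]
    · refine (AlternatingMap.fixArgs_apply _ _ _ _).trans (congrArg _ (funext fun s => ?_))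
      by_cases h : s ≤ i <;> simp [h, exchangeRight, z]
  have hsum : ∑ q : Equiv.Perm.ModSumCongr {s : Fin m // i ≤ s} {s : Fin m // s ≤ i},
      LinearMap.mul' S S (AlternatingMap.domCoprod.summand F₁ F₂ q z) = 0 := by
    have h0 := AlternatingMap.eq_zero_of_card_lt hcard (F₁.domCoprod F₂)
    have h1 : (F₁.domCoprod F₂) z = 0 := by rw [h0]; rfl
    rw [AlternatingMap.domCoprod_apply, sum_apply] at h1
    rw [← map_sum, h1, map_zero]
  replace hsum := (Finset.add_sum_erase Finset.univ _ (Finset.mem_univ (Quotient.mk'' 1 :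
    Equiv.Perm.ModSumCongr {s : Fin m // i ≤ s} {s : Fin m // s ≤ i}))).trans hsum
  have h1 := hterm 1
  have hl : exchangeLeft a b i 1 = a := by
    funext s; by_cases h : i ≤ s <;> simp [exchangeLeft, exchangeCols, h]
  have hr : exchangeRight a b i 1 = b := by
    funext s; by_cases h : s ≤ i <;> simp [exchangeRight, exchangeCols, h]
  rw [hl, hr, Equiv.Perm.sign_one, Units.val_one, one_zsmul] at h1
  rw [h1] at hsum
  rw [eq_neg_of_add_eq_zero_left hsum]
  refine W.neg_mem (W.sum_mem fun q hq => ?_)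
  induction q using Quotient.inductionOn' with | _ σ
  rw [hterm]
  refine W.zsmul_mem (hW σ ?_) _
  by_contra! hcon
  refine (Finset.mem_erase.1 hq).1 (Quotient.sound' ?_)
  rw [QuotientGroup.leftRel_apply, mul_one, inv_mem_iff]
  refine Equiv.Perm.mem_sumCongrHom_range_of_perm_mapsTo_inl ?_
  rintro _ ⟨s, rfl⟩
  rcases h : σ (Sum.inl s) with s' | s'
  · exact ⟨s', rfl⟩
  · exact absurd h (hcon s s')

lemma exchangeLeft_lt {a b : ColSeq m N} {i : Fin m} (hi : b.1 i < a.1 i)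
    {σ : Equiv.Perm (ExchangeIndex i)} (hσ : ∃ s s', σ (Sum.inl s) = Sum.inr s')
    {c : ColSeq m N} {τ : Equiv.Perm (Fin m)} (hc : c.1 = exchangeLeft a.1 b.1 i σ ∘ τ) :
    c < a := by
  have hcount : ∀ x, (Finset.univ.filter fun s => x ≤ c.1 s).card =
      (Finset.univ.filter fun s => x ≤ exchangeLeft a.1 b.1 i σ s).card := fun x => by
    rw [hc]; exact card_filter_comp_perm _ τ (fun y => x ≤ y)
  refine lt_of_le_of_ne (ColSeq.le_of_card_le _ _ fun x => ?_) fun h => ?_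
  · rw [hcount]
    rcases le_or_gt x (a.1 i) with hx | hx
    · refine Finset.card_le_card fun s hs => ?_
      simp only [Finset.mem_filter, Finset.mem_univ, true_and] at hs ⊢
      by_cases h : i ≤ s
      · exact hx.trans (a.2.monotone h)
      · simpa [exchangeLeft, h] using hs
    · have key : ∀ s, x ≤ exchangeLeft a.1 b.1 i σ s →
          ∃ h : i ≤ s, ∃ s', σ (Sum.inl ⟨s, h⟩) = Sum.inl s' ∧ x ≤ a.1 s' := by
        intro s hs
        by_cases h : i ≤ s
        · refine ⟨h, ?_⟩
          simp only [exchangeLeft, h, dite_true] at hs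
          rcases hs' : σ (Sum.inl ⟨s, h⟩) with s' | s'
          · exact ⟨s', rfl, by simpa [hs', exchangeCols] using hs⟩
          · rw [hs'] at hs
            have h1 : x ≤ b.1 s'.1 := hs
            exact absurd (h1.trans (b.2.monotone s'.2)) (not_le.2 (hi.trans hx))
        · simp only [exchangeLeft, h, dite_false] at hs
          exact absurd (hs.trans (a.2.monotone (not_le.1 h).le)) (not_le.2 hx)
      refine Finset.card_le_card_of_injOn
        (fun s => if h : i ≤ s then Sum.elim (fun s' => s'.1) (fun s' => s'.1)
          (σ (Sum.inl ⟨s, h⟩)) else s) ?_ ?_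
      · intro s hs
        obtain ⟨h, s', h1, h2⟩ := key s (by simpa using hs)
        simpa [h, h1] using h2
      · intro s hs t ht hst
        obtain ⟨h, s', h1, h2⟩ := key s (by simpa using hs)
        obtain ⟨h', t', h1', h2'⟩ := key t (by simpa using ht)
        simp only [h, h', h1, h1', dite_true, Sum.elim_inl] at hst
        have := σ.injective (h1.trans ((congrArg Sum.inl (Subtype.ext hst)).trans h1'.symm))
        simpa using this
  · obtain ⟨s₀, s', hs⟩ := hσ
    have h1 := hcount (a.1 i)
    rw [h] at h1
    have h2 : (Finset.univ.filter fun s => a.1 i ≤ exchangeLeft a.1 b.1 i σ s).card <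
        (Finset.univ.filter fun s => a.1 i ≤ a.1 s).card := by
      refine Finset.card_lt_card ⟨fun s hs => ?_, fun hsub => ?_⟩
      · simp only [Finset.mem_filter, Finset.mem_univ, true_and] at hs ⊢
        by_cases h : i ≤ s
        · exact a.2.monotone h
        · simpa [exchangeLeft, h] using hs
      · have h3 := hsub (x := s₀.1) (by simpa using a.2.monotone s₀.2)
        rw [Finset.mem_filter] at h3
        replace h3 := h3.2
        simp only [exchangeLeft, s₀.2, dite_true, Subtype.coe_eta, hs, exchangeCols,
          Sum.elim_inr] at h3
        exact absurd (h3.trans (b.2.monotone s'.2)) (not_le.2 hi)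
    omega

/-- Straightening of a violation of the order between `a` and `b`, lowering `a`. -/
lemma bracket_mul_bracket_mem_of_not_le {a b : ColSeq m N} (hab : ¬ a ≤ b) (W : AddSubgroup S)
    (hW : ∀ a' b' : ColSeq m N, a' < a → bracket M a'.1 * bracket M b'.1 ∈ W) :
    bracket M a.1 * bracket M b.1 ∈ W := by
  obtain ⟨i, hi⟩ : ∃ i, b.1 i < a.1 i := by
    by_contra! h
    exact hab h
  refine bracket_mul_bracket_mem M a.1 b.1 i W fun σ hσ => ?_
  rcases bracket_eq_zero_or_sorted M (exchangeLeft a.1 b.1 i σ) with h | ⟨a', τ, ha', h⟩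
  · simp [h]
  rcases bracket_eq_zero_or_sorted M (exchangeRight a.1 b.1 i σ) with h' | ⟨b', -, -, h'⟩
  · simp [h']
  have := hW a' b' (exchangeLeft_lt hi hσ ha')
  rcases h with h | h <;> rcases h' with h' | h' <;> simpa [h, h'] using this

/-- The product of the brackets in a list. -/
def tableauVal (T : List (ColSeq m N)) : S := (T.map fun c => bracket M c.1).prod

@[simp] lemma tableauVal_cons (c : ColSeq m N) (T : List (ColSeq m N)) :
    tableauVal M (c :: T) = bracket M c.1 * tableauVal M T := by
  simp [tableauVal]

/-- The span of the standard products of `L + 1` brackets whose least factor lies below `c`. -/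
def standardSpan (k : Type*) [CommRing k] [Algebra k S] (L : ℕ) (c : ColSeq m N) :
    Submodule k S :=
  Submodule.span k {x | ∃ (c' : ColSeq m N) (T : List (ColSeq m N)), c' ≤ c ∧ T.length = L ∧
    (c' :: T).Pairwise (· ≤ ·) ∧ x = tableauVal M (c' :: T)}

/-- The straightening law: a product of brackets is a combination of standard ones whose first
factor lies below any chosen factor. -/
theorem bracket_mul_tableauVal_mem (k : Type*) [CommRing k] [Algebra k S] (L : ℕ) :
    ∀ (c : ColSeq m N) (T : List (ColSeq m N)), T.length = L →
      bracket M c.1 * tableauVal M T ∈ standardSpan M k L c := by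
  induction L with
  | zero =>
    intro c T hT
    rw [List.length_eq_zero_iff] at hT
    subst hT
    exact Submodule.subset_span ⟨c, [], le_rfl, rfl, by simp, by simp⟩
  | succ L ih =>
    intro c
    induction c using WellFoundedLT.induction with | ind c ihc
    intro T hT
    obtain ⟨b, T, rfl⟩ := List.exists_cons_of_length_eq_add_one hT
    have hb := ih b T (by simpa using hT)
    rw [tableauVal_cons]
    have key : ∀ y ∈ standardSpan M k L b, bracket M c.1 * y ∈ standardSpan M k (L + 1) c := by
      intro y hy
      induction hy using Submodule.span_induction with
      | zero => simp
      | add x y _ _ hx hy => rw [mul_add]; exact Submodule.add_mem _ hx hy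
      | smul r x _ hx => rw [mul_smul_comm]; exact Submodule.smul_mem _ _ hx
      | mem x hx =>
        obtain ⟨b', T', -, hl, hs, rfl⟩ := hx
        by_cases hcb : c ≤ b'
        · refine Submodule.subset_span ⟨c, b' :: T', le_rfl, by simp [hl], ?_, by simp⟩
          refine List.pairwise_cons.2 ⟨fun d hd => ?_, hs⟩
          rcases List.mem_cons.1 hd with rfl | hd
          · exact hcb
          · exact hcb.trans ((List.pairwise_cons.1 hs).1 d hd)
        · rw [tableauVal_cons, ← mul_assoc]
          refine bracket_mul_bracket_mem_of_not_le M hcb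
            ((standardSpan M k (L + 1) c).toAddSubgroup.comap
              (AddMonoidHom.mulRight (tableauVal M T'))) fun a' d' ha' => ?_
          have := ihc a' ha' (d' :: T') (by simp [hl])
          rw [tableauVal_cons, ← mul_assoc] at this
          refine Submodule.span_mono ?_ this
          rintro x ⟨c', T'', h1, h2⟩
          exact ⟨c', T'', h1.trans ha'.le, h2⟩
    exact key _ hb

end Bracket

lemma map_bracket {S S' : Type*} [CommRing S] [CommRing S'] (φ : S →+* S') {m N : ℕ}
    (M : Matrix (Fin m) (Fin N) S) (c : Fin m → Fin N) :
    φ (bracket M c) = bracket (M.map φ) c := by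
  rw [bracket, bracket, RingHom.map_det]
  rfl

lemma map_tableauVal {S S' : Type*} [CommRing S] [CommRing S'] (φ : S →+* S') {m N : ℕ}
    (M : Matrix (Fin m) (Fin N) S) (T : List (ColSeq m N)) :
    φ (tableauVal M T) = tableauVal (M.map φ) T := by
  induction T with
  | nil => simp [tableauVal]
  | cons c T ih => simp [ih, map_bracket]

lemma tableauVal_mul {S : Type*} [CommRing S] {m N : ℕ} (P : Matrix (Fin m) (Fin m) S)
    (M : Matrix (Fin m) (Fin N) S) (T : List (ColSeq m N)) :
    tableauVal (P * M) T = P.det ^ T.length * tableauVal M T := by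
  induction T with
  | nil => simp [tableauVal]
  | cons c T ih =>
    have h : bracket (P * M) c.1 = P.det * bracket M c.1 := by
      rw [bracket, bracket, ← Matrix.det_mul]
      rfl
    rw [tableauVal_cons, tableauVal_cons, ih, h, List.length_cons]
    ring

/-- Standard tableaux with `L` rows, each an increasing sequence of `m` columns. -/
abbrev StdTableau (m N L : ℕ) :=
  {T : List (ColSeq m N) // T.length = L ∧ T.Pairwise (· ≤ ·)}

open scoped MonomialOrder

lemma MonomialOrder.linearIndependent_of_degree_injective {σ ι k : Type*} [Field k]
    (o : MonomialOrder σ) (f : ι → MvPolynomial σ k) (hf : ∀ i, f i ≠ 0)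
    (hinj : Function.Injective fun i => o.degree (f i)) : LinearIndependent k f := by
  classical
  rw [linearIndependent_iff']
  intro s g hg
  by_contra! hne
  obtain ⟨i, his, hi⟩ := hne
  obtain ⟨j, hj, hmax⟩ := Finset.exists_max_image (s.filter fun i => g i ≠ 0)
    (fun i => o.toSyn (o.degree (f i))) ⟨i, by simp [his, hi]⟩
  rw [Finset.mem_filter] at hj
  have hcoeff := congrArg (MvPolynomial.coeff (o.degree (f j))) hg
  rw [MvPolynomial.coeff_sum, MvPolynomial.coeff_zero, Finset.sum_eq_single j] at hcoeff
  · rw [MvPolynomial.coeff_smul, smul_eq_mul, mul_eq_zero] at hcoeff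
    exact hcoeff.elim hj.2 ((o.coeff_degree_ne_zero_iff).2 (hf j))
  · intro l hl hlj
    by_cases h : g l = 0
    · simp [h]
    · rw [MvPolynomial.coeff_smul, o.coeff_eq_zero_of_lt, smul_zero]
      exact lt_of_le_of_ne (hmax l (by simp [hl, h])) fun e => hlj (hinj (o.toSyn.injective e))
  · exact fun h => absurd hj.1 h

section Leading

variable (k : Type*) [Field k] {m N : ℕ}

/-- The generic matrix with its variables ordered lexicographically by position. -/
def lexMat (m N : ℕ) : Matrix (Fin m) (Fin N) (MvPolynomial (Fin m ×ₗ Fin N) k) :=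
  fun i j => MvPolynomial.X (toLex (i, j))

/-- The exponent of the monomial `∏ i, x (i, c i)`. -/
def diagExp (c : Fin m → Fin N) : (Fin m ×ₗ Fin N) →₀ ℕ :=
  ∑ i, Finsupp.single (toLex (i, c i)) 1

lemma diagExp_apply (c : Fin m → Fin N) (i : Fin m) (j : Fin N) :
    diagExp c (toLex (i, j)) = if c i = j then 1 else 0 := by
  rw [diagExp, Finsupp.finsetSum_apply, Finset.sum_eq_single i]
  · simp [Finsupp.single_apply]
  · intro l _ hl
    simp [hl]
  · simp

lemma bracket_lexMat (c : Fin m → Fin N) :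
    bracket (lexMat k m N) c =
      ∑ σ : Equiv.Perm (Fin m), (Equiv.Perm.sign σ : ℤ) •
        MvPolynomial.monomial (diagExp (c ∘ σ)) (1 : k) := by
  rw [bracket, ← Matrix.det_transpose, Matrix.det_apply]
  refine Finset.sum_congr rfl fun σ _ => ?_
  rw [Units.smul_def, diagExp, MvPolynomial.monomial_sum_one]
  rfl

lemma diagExp_comp_perm_lt {c : Fin m → Fin N} (hc : StrictMono c) {σ : Equiv.Perm (Fin m)}
    (hσ : σ ≠ 1) : diagExp (c ∘ σ) ≺[MonomialOrder.lex] diagExp c := by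
  classical
  rw [MonomialOrder.lex_lt_iff]
  have hne : (Finset.univ.filter fun i => σ i ≠ i).Nonempty := by
    by_contra h
    rw [Finset.not_nonempty_iff_eq_empty, Finset.filter_eq_empty_iff] at h
    exact hσ (Equiv.ext fun i => by simpa using h (Finset.mem_univ i))
  set i := (Finset.univ.filter fun i => σ i ≠ i).min' hne with hi
  have hi1 : σ i ≠ i := (Finset.mem_filter.1 (Finset.min'_mem _ hne)).2
  have hi2 : ∀ l < i, σ l = l := fun l hl => by
    by_contra h
    exact absurd (Finset.min'_le (Finset.univ.filter fun i => σ i ≠ i) l (by simp [h]))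
      (not_le.2 hl)
  have hi3 : i < σ i := by
    refine lt_of_le_of_ne (not_lt.1 fun h => hi1 (σ.injective (hi2 _ h))) (Ne.symm hi1)
  refine ⟨toLex (i, c i), fun x hx => ?_, ?_⟩
  · obtain ⟨⟨l, j⟩, rfl⟩ := toLex.surjective x
    change diagExp (c ∘ σ) (toLex (l, j)) = diagExp c (toLex (l, j))
    rw [diagExp_apply, diagExp_apply]
    rcases Prod.Lex.toLex_lt_toLex.1 hx with hl | ⟨hl, hj⟩
    · simp [hi2 l hl]
    · simp only at hl hj
      subst hl
      exact (if_neg (hj.trans (hc hi3)).ne').trans (if_neg hj.ne').symm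
  · change diagExp (c ∘ σ) (toLex (i, c i)) < diagExp c (toLex (i, c i))
    rw [diagExp_apply, diagExp_apply, if_neg, if_pos rfl]
    · exact one_pos
    · exact (hc hi3).ne'

lemma coeff_bracket_lexMat (c : ColSeq m N) :
    (bracket (lexMat k m N) c.1).coeff (diagExp c.1) = 1 := by
  rw [bracket_lexMat, MvPolynomial.coeff_sum, Finset.sum_eq_single 1]
  · simp
  · intro σ _ hσ
    have h : diagExp (c.1 ∘ σ) ≠ diagExp c.1 := fun h =>
      (diagExp_comp_perm_lt c.2 hσ).ne (congrArg _ h)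
    rw [← Int.cast_smul_eq_zsmul k, MvPolynomial.coeff_smul, MvPolynomial.coeff_monomial, if_neg h,
      smul_zero]
  · simp

lemma bracket_lexMat_ne_zero (c : ColSeq m N) : bracket (lexMat k m N) c.1 ≠ 0 := fun h => by
  simpa [h] using coeff_bracket_lexMat k c

lemma degree_bracket_lexMat (c : ColSeq m N) :
    MonomialOrder.lex.degree (bracket (lexMat k m N) c.1) = diagExp c.1 := by
  refine MonomialOrder.lex.toSyn.injective (le_antisymm ?_ ?_)
  · rw [bracket_lexMat]
    refine MonomialOrder.degree_sum_le.trans (Finset.sup_le fun σ _ => ?_)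
    rw [← Int.cast_smul_eq_zsmul k]
    refine MonomialOrder.degree_smul_le.trans ((MonomialOrder.degree_monomial_le _).trans ?_)
    by_cases hσ : σ = 1
    · simp [hσ]
    · exact (diagExp_comp_perm_lt c.2 hσ).le
  · refine MonomialOrder.le_degree ?_
    rw [MvPolynomial.mem_support_iff, coeff_bracket_lexMat]
    exact one_ne_zero

lemma tableauVal_lexMat_ne_zero (T : List (ColSeq m N)) : tableauVal (lexMat k m N) T ≠ 0 := by
  refine List.prod_ne_zero ?_
  simp only [List.mem_map, not_exists, not_and]
  exact fun c _ => bracket_lexMat_ne_zero k c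

lemma degree_tableauVal_lexMat (T : List (ColSeq m N)) :
    MonomialOrder.lex.degree (tableauVal (lexMat k m N) T) =
      (T.map fun c => diagExp c.1).sum := by
  induction T with
  | nil => simp [tableauVal]
  | cons c T ih =>
    rw [tableauVal_cons, MonomialOrder.degree_mul (bracket_lexMat_ne_zero k c)
      (tableauVal_lexMat_ne_zero k T), ih, degree_bracket_lexMat, List.map_cons, List.sum_cons]

lemma sum_diagExp_apply (T : List (ColSeq m N)) (i : Fin m) (j : Fin N) :
    (T.map fun c => diagExp c.1).sum (toLex (i, j)) = (T.map fun c => c.1 i).count j := by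
  induction T with
  | nil => simp
  | cons c T ih =>
    rw [List.map_cons, List.sum_cons, Finsupp.add_apply, ih, diagExp_apply, List.map_cons,
      List.count_cons, add_comm]
    simp

lemma StdTableau.ext_of_sum_diagExp {L : ℕ} (T T' : StdTableau m N L)
    (h : (T.1.map fun c => diagExp c.1).sum = (T'.1.map fun c => diagExp c.1).sum) : T = T' := by
  have hrow : ∀ i, T.1.map (fun c => c.1 i) = T'.1.map (fun c => c.1 i) := by
    intro i
    refine List.Perm.eq_of_pairwise (le := (· ≤ ·)) (fun a b _ _ => le_antisymm)
      (T.2.2.map _ fun a b hab => hab i) (T'.2.2.map _ fun a b hab => hab i) ?_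
    rw [List.perm_iff_count]
    intro j
    rw [← sum_diagExp_apply, ← sum_diagExp_apply, h]
  refine Subtype.ext (List.ext_getElem (T.2.1.trans T'.2.1.symm) fun l h1 h2 => ?_)
  refine Subtype.ext (funext fun i => ?_)
  have := congrArg (fun l' => l'[l]?) (hrow i)
  simpa [h1, h2] using this

theorem linearIndependent_tableauVal_lexMat (L : ℕ) :
    LinearIndependent k fun T : StdTableau m N L => tableauVal (lexMat k m N) T.1 := by
  refine MonomialOrder.lex.linearIndependent_of_degree_injective _
    (fun T => tableauVal_lexMat_ne_zero k T.1) fun T T' h => ?_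
  simp only [degree_tableauVal_lexMat] at h
  exact T.ext_of_sum_diagExp T' h

end Leading

section Extended

variable (k : Type*) [Field k] {m n : ℕ}

/-- The generic matrix extended by an identity block, whose maximal minors are, up to sign, all
the minors of the generic matrix. -/
def extMat (m n : ℕ) : Matrix (Fin m) (Fin (n + m)) (MvPolynomial (Fin m × Fin n) k) :=
  fun i => Fin.append (genMat k m n i) ((1 : Matrix (Fin m) (Fin m) _) i)

/-- The columns of the identity block. -/
def lastCols (m n : ℕ) : ColSeq m (n + m) := ⟨Fin.natAdd n, fun i j h => by simpa using h⟩

lemma bracket_extMat_lastCols : bracket (extMat k m n) (lastCols m n).1 = 1 := by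
  have : (extMat k m n).submatrix id (lastCols m n).1 = 1 := by
    refine Matrix.ext fun i j => ?_
    exact Fin.append_right (genMat k m n i) ((1 : Matrix (Fin m) (Fin m) _) i) j
  rw [bracket, this, Matrix.det_one]

lemma le_lastCols (c : ColSeq m (n + m)) : c ≤ lastCols m n := by
  intro i
  have h : (Finset.Ioi i).card ≤ (Finset.Ioi (c.1 i)).card :=
    Finset.card_le_card_of_injOn c.1 (fun s hs => by simpa using c.2 (by simpa using hs))
      c.2.injective.injOn
  rw [Fin.card_Ioi, Fin.card_Ioi] at h
  rw [Fin.le_def]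
  have := i.2
  have := (c.1 i).2
  simp only [lastCols, Fin.val_natAdd]
  omega

lemma linearIndependent_tableauVal_extMat_aux (L : ℕ) (K : Type*) [Field K]
    [Algebra (MvPolynomial (Fin m ×ₗ Fin (n + m)) k) K]
    [IsFractionRing (MvPolynomial (Fin m ×ₗ Fin (n + m)) k) K] [Algebra k K]
    [IsScalarTower k (MvPolynomial (Fin m ×ₗ Fin (n + m)) k) K] :
    LinearIndependent k fun T : StdTableau m (n + m) L => tableauVal (extMat k m n) T.1 := by
  let R := MvPolynomial (Fin m ×ₗ Fin (n + m)) k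
  let Y : Matrix (Fin m) (Fin (n + m)) K := (lexMat k m (n + m)).map (algebraMap R K)
  let Y₂ : Matrix (Fin m) (Fin m) K := Y.submatrix id (lastCols m n).1
  have hY₂ : Y₂.det ≠ 0 := by
    have h : Y₂.det = algebraMap R K (bracket (lexMat k m (n + m)) (lastCols m n).1) := by
      rw [map_bracket]; rfl
    rw [h]
    exact (map_ne_zero_iff _ (IsFractionRing.injective R K)).2 (bracket_lexMat_ne_zero k _)
  have hunit : IsUnit Y₂.det := isUnit_iff_ne_zero.2 hY₂
  let φ : MvPolynomial (Fin m × Fin n) k →ₐ[k] K :=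
    MvPolynomial.aeval fun x => (Y₂⁻¹ * Y) x.1 (Fin.castAdd m x.2)
  have hφ : (extMat k m n).map φ = Y₂⁻¹ * Y := by
    ext i j
    induction j using Fin.addCases with
    | left j => simp [extMat, genMat, φ]
    | right j =>
      have h : (Y₂⁻¹ * Y) i (Fin.natAdd n j) = (Y₂⁻¹ * Y₂) i j := rfl
      rw [h, Matrix.nonsing_inv_mul _ hunit]
      simp [extMat, Matrix.one_apply, apply_ite φ]
  let d := Y₂⁻¹.det ^ L
  have hd : d ≠ 0 := pow_ne_zero _ (by
    rw [Matrix.det_nonsing_inv, Ring.inverse_eq_inv']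
    exact inv_ne_zero hY₂)
  let ψ : R →ₗ[k] K := LinearMap.mulLeft k d ∘ₗ (IsScalarTower.toAlgHom k R K).toLinearMap
  have hψ : Function.Injective ψ :=
    (mul_right_injective₀ hd).comp (IsFractionRing.injective R K)
  refine LinearIndependent.of_comp φ.toLinearMap ?_
  convert (linearIndependent_tableauVal_lexMat k (m := m) (N := n + m) L).map_injOn ψ hψ.injOn
    using 1
  funext T
  have h1 := map_tableauVal φ.toRingHom (extMat k m n) T.1
  have h2 := map_tableauVal (algebraMap R K) (lexMat k m (n + m)) T.1
  have h3 : (extMat k m n).map φ.toRingHom = Y₂⁻¹ * Y := hφ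
  rw [h3, tableauVal_mul, T.2.1] at h1
  refine h1.trans ?_
  rw [← h2]
  rfl

theorem linearIndependent_tableauVal_extMat (L : ℕ) :
    LinearIndependent k fun T : StdTableau m (n + m) L => tableauVal (extMat k m n) T.1 :=
  linearIndependent_tableauVal_extMat_aux k L
    (FractionRing (MvPolynomial (Fin m ×ₗ Fin (n + m)) k))

end Extended

/-- The number of entries of `c` smaller than `x`. -/
def numBelow {m N : ℕ} (x : ℕ) (c : Fin m → Fin N) : ℕ :=
  (Finset.univ.filter fun s => (c s : ℕ) < x).card

lemma numBelow_anti {m N : ℕ} (x : ℕ) {c c' : Fin m → Fin N} (h : c' ≤ c) :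
    numBelow x c ≤ numBelow x c' :=
  Finset.card_le_card fun s hs => by
    simp only [Finset.mem_filter, Finset.mem_univ, true_and] at hs ⊢
    exact lt_of_le_of_lt (h s) hs

lemma lt_of_lt_numBelow {m N : ℕ} {x : ℕ} {c : Fin m → Fin N} (hc : StrictMono c) {i : Fin m}
    (hi : (i : ℕ) < numBelow x c) : (c i : ℕ) < x := by
  by_contra! h
  have : numBelow x c ≤ (Finset.Iio i).card := Finset.card_le_card fun s hs => by
    simp only [Finset.mem_filter, Finset.mem_univ, true_and] at hs
    rw [Finset.mem_Iio, ← hc.lt_iff_lt, Fin.lt_def]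
    omega
  rw [Fin.card_Iio] at this
  omega

lemma numBelow_le {m N : ℕ} (x : ℕ) (c : Fin m → Fin N) : numBelow x c ≤ m :=
  (Finset.card_filter_le _ _).trans (by simp)

/-- A weak form of Laplace expansion: a determinant lies in the ideal of the minors of its first
`t` columns. -/
lemma det_mem_span_minors {S : Type*} [CommRing S] {t s : ℕ} (h : t ≤ s) :
    ∀ M : Matrix (Fin s) (Fin s) S, M.det ∈ Ideal.span {x | ∃ f : Fin t → Fin s,
      StrictMono f ∧ x = (M.submatrix f (Fin.castLE h)).det} := by
  induction s, h using Nat.le_induction with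
  | base => exact fun M => Ideal.subset_span ⟨id, strictMono_id, rfl⟩
  | succ s h ih =>
    intro M
    rw [Matrix.det_succ_column M (Fin.last s)]
    refine Ideal.sum_mem _ fun i _ => Ideal.mul_mem_left _ _ ?_
    refine Ideal.span_mono ?_ (ih (M.submatrix i.succAbove (Fin.last s).succAbove))
    rintro x ⟨f, hf, rfl⟩
    refine ⟨i.succAbove ∘ f, (Fin.strictMono_succAbove i).comp hf, ?_⟩
    rw [Matrix.submatrix_submatrix, Fin.succAbove_last]
    rfl

section Standard

variable (k : Type*) [Field k] {m n : ℕ}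

/-- Every minor of the generic matrix is, up to sign, a maximal minor of the extended matrix. -/
lemma det_genMat_submatrix_eq_bracket {t : ℕ} {f : Fin t → Fin m} (hf : Function.Injective f)
    (g : Fin t → Fin n) :
    ((genMat k m n).submatrix f g).det = 0 ∨ ∃ c : ColSeq m (n + m),
      (∀ x, (∀ i, (g i : ℕ) < x) → t ≤ numBelow x c.1) ∧
      (((genMat k m n).submatrix f g).det = bracket (extMat k m n) c.1 ∨
        ((genMat k m n).submatrix f g).det = - bracket (extMat k m n) c.1) := by
  classical
  let e : Fin t ⊕ ((Set.range f)ᶜ : Set (Fin m)) ≃ Fin m :=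
    ((Equiv.ofInjective f hf).sumCongr (Equiv.refl _)).trans (Equiv.Set.sumCompl (Set.range f))
  have hel : ∀ i, e (Sum.inl i) = f i := fun i => rfl
  have her : ∀ y, e (Sum.inr y) = y.1 := fun y => rfl
  let c' : Fin m → Fin (n + m) :=
    Sum.elim (fun i => Fin.castAdd m (g i)) (fun y => Fin.natAdd n y.1) ∘ e.symm
  have hcl : ∀ i, c' (e (Sum.inl i)) = Fin.castAdd m (g i) := fun i =>
    congrArg (Sum.elim _ _) (e.symm_apply_apply _)
  have hcr : ∀ y, c' (e (Sum.inr y)) = Fin.natAdd n y.1 := fun y =>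
    congrArg (Sum.elim _ _) (e.symm_apply_apply _)
  have hdet : ((genMat k m n).submatrix f g).det = bracket (extMat k m n) c' := by
    rw [bracket, ← Matrix.det_submatrix_equiv_self e, Matrix.submatrix_submatrix]
    have : (extMat k m n).submatrix (id ∘ e) (c' ∘ e) =
        Matrix.fromBlocks ((genMat k m n).submatrix f g) 0
          ((genMat k m n).submatrix (fun y => y.1) g) 1 := by
      refine Matrix.ext ?_
      rintro (i | y) (j | y')
      · change extMat k m n (e _) (c' (e _)) = _
        rw [hcl, hel]
        simp [extMat]
      · have hne : f i ≠ y'.1 := fun h => y'.2 ⟨i, h⟩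
        change extMat k m n (e _) (c' (e _)) = _
        rw [hcr, hel]
        simp [extMat, hne]
      · change extMat k m n (e _) (c' (e _)) = _
        rw [hcl, her]
        simp [extMat]
      · change extMat k m n (e _) (c' (e _)) = _
        rw [hcr, her]
        simp [extMat, Matrix.one_apply, Subtype.ext_iff]
    rw [this, Matrix.det_fromBlocks_zero₁₂, Matrix.det_one, mul_one]
  rw [hdet]
  refine (bracket_eq_zero_or_sorted (extMat k m n) c').imp_right ?_
  rintro ⟨c, τ, hc, h⟩
  refine ⟨c, fun x hx => ?_, h⟩
  rw [hc, numBelow, card_filter_comp_perm c' τ fun y => (y : ℕ) < x]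
  calc t = (Finset.univ : Finset (Fin t)).card := by simp
    _ ≤ _ := Finset.card_le_card_of_injOn f (fun i _ => ?_) hf.injOn
  have : c' (f i) = Fin.castAdd m (g i) := hcl i
  simpa [this] using hx i

lemma mem_span_range_tableauVal (y : MvPolynomial (Fin m × Fin n) k) :
    y ∈ Submodule.span k (Set.range fun T : List (ColSeq m (n + m)) =>
      tableauVal (extMat k m n) T) := by
  set V := Submodule.span k (Set.range fun T : List (ColSeq m (n + m)) =>
      tableauVal (extMat k m n) T) with hV
  have hmul : ∀ (c : ColSeq m (n + m)), ∀ y ∈ V, y * bracket (extMat k m n) c.1 ∈ V := by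
    intro c y hy
    induction hy using Submodule.span_induction with
    | zero => simp
    | add x y _ _ hx hy => rw [add_mul]; exact V.add_mem hx hy
    | smul a x _ hx => rw [smul_mul_assoc]; exact V.smul_mem _ hx
    | mem x hx =>
      obtain ⟨T, rfl⟩ := hx
      exact Submodule.subset_span ⟨c :: T, by simp [mul_comm]⟩
  induction y using MvPolynomial.induction_on with
  | C a =>
    rw [MvPolynomial.C_eq_smul_one]
    exact V.smul_mem _ (Submodule.subset_span ⟨[], by simp [tableauVal]⟩)
  | add y z hy hz => exact V.add_mem hy hz
  | mul_X y x hy =>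
    have hx : (MvPolynomial.X x : MvPolynomial (Fin m × Fin n) k) =
        ((genMat k m n).submatrix (fun _ : Fin 1 => x.1) (fun _ : Fin 1 => x.2)).det := by
      simp [genMat]
    rw [hx]
    rcases det_genMat_submatrix_eq_bracket k
      (Function.injective_of_subsingleton (fun _ : Fin 1 => x.1)) (fun _ => x.2) with
      h | ⟨c, -, h | h⟩
    · rw [h, mul_zero]; exact V.zero_mem
    · rw [h]; exact hmul c y hy
    · rw [h, mul_neg]; exact V.neg_mem (hmul c y hy)

/-- The span of the standard tableaux with `L` rows one of which satisfies `P`. -/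
def stdSpan (m n L : ℕ) (P : ColSeq m (n + m) → Prop) :
    Submodule k (MvPolynomial (Fin m × Fin n) k) :=
  Submodule.span k ((fun T : StdTableau m (n + m) L => tableauVal (extMat k m n) T.1) ''
    {T | ∃ c ∈ T.1, P c})

lemma stdSpan_mono (P : ColSeq m (n + m) → Prop) : Monotone fun L => stdSpan k m n L P := by
  refine monotone_nat_of_le_succ fun L => Submodule.span_le.2 ?_
  rintro _ ⟨T, ⟨c, hc, hP⟩, rfl⟩
  refine Submodule.subset_span ⟨⟨T.1 ++ [lastCols m n], by simp [T.2.1], ?_⟩,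
    ⟨c, by simp [hc], hP⟩, ?_⟩
  · refine List.pairwise_append.2 ⟨T.2.2, by simp, fun d _ d' hd' => ?_⟩
    rw [List.mem_singleton.1 hd']
    exact le_lastCols d
  · simp [tableauVal, bracket_extMat_lastCols]

lemma exists_mem_stdSpan {P : ColSeq m (n + m) → Prop} (hP : ∀ c c', c' ≤ c → P c → P c')
    {y : MvPolynomial (Fin m × Fin n) k}
    (hy : y ∈ Ideal.span {x | ∃ c : ColSeq m (n + m), P c ∧ x = bracket (extMat k m n) c.1}) :
    ∃ L, y ∈ stdSpan k m n L P := by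
  rw [← Submodule.mem_iSup_of_directed _ (stdSpan_mono k P).directed_le]
  induction hy using Submodule.closure_induction with
  | zero => exact Submodule.zero_mem _
  | add x y _ _ hx hy => exact Submodule.add_mem _ hx hy
  | smul_mem z x hx =>
    obtain ⟨c, hc, rfl⟩ := hx
    rw [smul_eq_mul, mul_comm]
    have hz := mem_span_range_tableauVal k z
    induction hz using Submodule.span_induction with
    | zero => simp
    | add x y _ _ hx hy => rw [mul_add]; exact Submodule.add_mem _ hx hy
    | smul a x _ hx => rw [mul_smul_comm]; exact Submodule.smul_mem _ _ hx
    | mem x hx =>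
      obtain ⟨T, rfl⟩ := hx
      refine Submodule.mem_iSup_of_mem (T.length + 1) ?_
      refine Submodule.span_mono ?_
        (bracket_mul_tableauVal_mem (extMat k m n) k T.length c T rfl)
      rintro x ⟨c', T', hle, hl, hs, rfl⟩
      exact ⟨⟨c' :: T', by simp [hl], hs⟩, ⟨c', by simp, hP c c' hle hc⟩, rfl⟩

lemma mem_stdSpan_and {L : ℕ} {P Q : ColSeq m (n + m) → Prop}
    (hP : ∀ c c', c' ≤ c → P c → P c') (hQ : ∀ c c', c' ≤ c → Q c → Q c')
    {y : MvPolynomial (Fin m × Fin n) k} (h₁ : y ∈ stdSpan k m n L P)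
    (h₂ : y ∈ stdSpan k m n L Q) : y ∈ stdSpan k m n L fun c => P c ∧ Q c := by
  rw [stdSpan, Finsupp.mem_span_image_iff_linearCombination] at h₁ h₂ ⊢
  obtain ⟨l, hl, rfl⟩ := h₁
  obtain ⟨l', hl', h⟩ := h₂
  obtain rfl : l' = l := linearIndependent_tableauVal_extMat k L h
  refine ⟨l', fun T hT => ?_, rfl⟩
  obtain ⟨c, hc, hcP⟩ := hl hT
  obtain ⟨c', hc', hcQ⟩ := hl' hT
  have : Std.Symm fun a b : ColSeq m (n + m) => a ≤ b ∨ b ≤ a := ⟨fun _ _ => Or.symm⟩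
  have hcmp : c ≤ c' ∨ c' ≤ c :=
    List.Pairwise.forall_of_forall (R := fun a b : ColSeq m (n + m) => a ≤ b ∨ b ≤ a)
      (fun _ _ => Or.inl le_rfl) (T.2.2.imp Or.inl) hc hc'
  rcases hcmp with h | h
  · exact ⟨c, hc, hcP, hQ _ _ h hcQ⟩
  · exact ⟨c', hc', hP _ _ h hcP, hcQ⟩

lemma span_bracket_inf_le {P Q : ColSeq m (n + m) → Prop}
    (hP : ∀ c c', c' ≤ c → P c → P c') (hQ : ∀ c c', c' ≤ c → Q c → Q c') :
    Ideal.span {x | ∃ c : ColSeq m (n + m), P c ∧ x = bracket (extMat k m n) c.1} ⊓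
      Ideal.span {x | ∃ c : ColSeq m (n + m), Q c ∧ x = bracket (extMat k m n) c.1} ≤
    Ideal.span {x | ∃ c : ColSeq m (n + m), (P c ∧ Q c) ∧ x = bracket (extMat k m n) c.1} := by
  rintro y ⟨h₁, h₂⟩
  obtain ⟨L₁, h₁⟩ := exists_mem_stdSpan k hP h₁
  obtain ⟨L₂, h₂⟩ := exists_mem_stdSpan k hQ h₂
  have h := mem_stdSpan_and k hP hQ (stdSpan_mono k P (le_max_left L₁ L₂) h₁)
    (stdSpan_mono k Q (le_max_right L₁ L₂) h₂)
  refine (Submodule.span_le (p := Submodule.restrictScalars k (Ideal.span _))).2 ?_ h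
  rintro _ ⟨T, ⟨c, hc, hPQ⟩, rfl⟩
  exact Ideal.mem_of_dvd _ (List.dvd_prod (List.mem_map_of_mem hc))
    (Ideal.subset_span ⟨c, hPQ, rfl⟩)

/-- A minor with columns among the first `x` is a bracket with many columns below `x`. -/
lemma span_minors_le_span_bracket (x t : ℕ) :
    Ideal.span {M | ∃ (f : Fin t → Fin m) (g : Fin t → Fin n), StrictMono f ∧ StrictMono g ∧
      (∀ i, (g i : ℕ) < x) ∧ M = ((genMat k m n).submatrix f g).det} ≤
    Ideal.span {y | ∃ c : ColSeq m (n + m), t ≤ numBelow x c.1 ∧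
      y = bracket (extMat k m n) c.1} := by
  rw [Ideal.span_le]
  rintro _ ⟨f, g, hf, -, hx, rfl⟩
  rcases det_genMat_submatrix_eq_bracket k hf.injective g with h | ⟨c, hc, h | h⟩
  · rw [h]; exact Ideal.zero_mem _
  · rw [h]; exact Ideal.subset_span ⟨c, hc x hx, rfl⟩
  · rw [h]; exact neg_mem (Ideal.subset_span ⟨c, hc x hx, rfl⟩)

/-- A bracket with at least `t` columns in the generic block and at least `r` columns below `a`
is a combination of `t`-minors with at least `r` columns below `a`. -/
lemma bracket_extMat_mem {a r t : ℕ} (hrt : r ≤ t) (c : ColSeq m (n + m))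
    (hn : t ≤ numBelow n c.1) (ha : r ≤ numBelow a c.1) :
    bracket (extMat k m n) c.1 ∈ Ideal.span {M | ∃ (f : Fin t → Fin m) (g : Fin t → Fin n),
      StrictMono f ∧ StrictMono g ∧ r ≤ numBelow a g ∧
      M = ((genMat k m n).submatrix f g).det} := by
  have htm : t ≤ m := hn.trans (numBelow_le _ _)
  refine Ideal.span_mono ?_ (det_mem_span_minors htm ((extMat k m n).submatrix id c.1))
  rintro _ ⟨f, hf, rfl⟩
  have hlt : ∀ i : Fin t, (c.1 (Fin.castLE htm i) : ℕ) < n := fun i =>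
    lt_of_lt_numBelow c.2 (i.2.trans_le hn)
  refine ⟨f, fun i => ⟨c.1 (Fin.castLE htm i), hlt i⟩, hf, fun i j hij => ?_, ?_, ?_⟩
  · exact c.2 ((Fin.castLE_lt_castLE_iff htm).2 hij)
  · calc r = (Finset.univ : Finset (Fin r)).card := by simp
      _ ≤ _ := Finset.card_le_card_of_injOn (Fin.castLE hrt) (fun i _ => ?_)
        (Fin.castLE_injective hrt).injOn
    have : (c.1 (Fin.castLE htm (Fin.castLE hrt i)) : ℕ) < a :=
      lt_of_lt_numBelow c.2 (i.2.trans_le ha)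
    simpa using this
  · congr 1
    refine Matrix.ext fun i j => ?_
    exact Fin.append_left (genMat k m n (f i)) ((1 : Matrix (Fin m) (Fin m) _) (f i))
      ⟨c.1 (Fin.castLE htm j), hlt j⟩

lemma det_genMat_submatrix_ne_zero {t : ℕ} {f : Fin t → Fin m} {g : Fin t → Fin n}
    (hf : Function.Injective f) (hg : Function.Injective g) :
    ((genMat k m n).submatrix f g).det ≠ 0 := by
  have h : (genMat k m n).submatrix f g =
      (Matrix.mvPolynomialX (Fin t) (Fin t) k).map (MvPolynomial.rename (Prod.map f g)) := by
    refine Matrix.ext fun i j => ?_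
    simp [genMat]
  have h' := AlgHom.map_det (MvPolynomial.rename (R := k) (Prod.map f g))
    (Matrix.mvPolynomialX (Fin t) (Fin t) k)
  rw [AlgHom.mapMatrix_apply] at h'
  rw [h, ← h', Ne, map_eq_zero_iff _ (MvPolynomial.rename_injective _ (hf.prodMap hg))]
  exact Matrix.det_mvPolynomialX_ne_zero (Fin t) k

lemma weightedTotalDegree_minor {a p q t : ℕ} {f : Fin t → Fin m} {g : Fin t → Fin n}
    (hf : Function.Injective f) (hg : Function.Injective g) :
    MvPolynomial.weightedTotalDegree (wt m n a p q) ((genMat k m n).submatrix f g).det =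
      p * numBelow a g + q * (t - numBelow a g) := by
  have hne := det_genMat_submatrix_ne_zero k hf hg
  have hhom : MvPolynomial.IsWeightedHomogeneous (wt m n a p q)
      ((genMat k m n).submatrix f g).det (∑ i, if (g i : ℕ) < a then p else q) := by
    rw [Matrix.det_apply]
    refine MvPolynomial.IsWeightedHomogeneous.sum _ _ _ fun σ _ => ?_
    rw [Units.smul_def, ← Int.cast_smul_eq_zsmul k, MvPolynomial.smul_eq_C_mul]
    have := (MvPolynomial.isWeightedHomogeneous_C (wt m n a p q)
      (((Equiv.Perm.sign σ : ℤ)) : k)).mul (MvPolynomial.IsWeightedHomogeneous.prod Finset.univ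
        (fun i => (genMat k m n).submatrix f g (σ i) i) (fun i => if (g i : ℕ) < a then p else q)
        (w := wt m n a p q) fun i _ =>
          MvPolynomial.isWeightedHomogeneous_X k (wt m n a p q) (f (σ i), g i))
    rwa [zero_add] at this
  have h := hhom.weighted_total_degree hne
  rw [MvPolynomial.weightedTotalDegree_coe _ _ hne, WithBot.coe_inj] at h
  rw [h, Finset.sum_ite, Finset.sum_const, Finset.sum_const, smul_eq_mul, smul_eq_mul, mul_comm,
    mul_comm _ q]
  have := Finset.card_filter_add_card_filter_not (s := (Finset.univ : Finset (Fin t)))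
    (fun i => (g i : ℕ) < a)
  rw [Finset.card_univ, Fintype.card_fin] at this
  congr 2
  rw [numBelow]
  omega

end Standard

lemma le_iff_degree_le {p q t d r s : ℕ} (hpq : p < q) (hs : s ≤ t)
    (hr : (r : ℤ) = (⌈((t * q : ℚ) - d) / ((q : ℚ) - p)⌉).toNat) :
    r ≤ s ↔ p * s + q * (t - s) ≤ d := by
  have hr' : r = (⌈((t * q : ℚ) - d) / ((q : ℚ) - p)⌉).toNat := by exact_mod_cast hr
  have hpos : (0 : ℚ) < (q : ℚ) - p := sub_pos.2 (by exact_mod_cast hpq)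
  rw [hr', Int.toNat_le, Int.ceil_le, div_le_iff₀ hpos, ← Nat.cast_le (α := ℚ)]
  push_cast [Nat.cast_sub hs]
  constructor <;> intro h <;> linarith

/-- With the grading `deg x_{ij} = p` for `j` among the first `a` columns and `q > p`
otherwise, and `r = ⌈(tq−d)/(q−p)⌉`, the ideal generated by the `t`-minors of degree
`≤ d` equals `I_t(X) ∩ I_r(A)`, where `A` is the submatrix of the first `a` columns. -/
theorem stmt_10 (k : Type*) [Field k] (m n a p q t d : ℕ)
    (hp : 0 < p) (hpq : p < q) (htm : t ≤ m) (htn : t ≤ n) (han : a ≤ n)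
    (hd : p * t ≤ d) (r : ℕ)
    (hr : (r : ℤ) = (⌈((t * q : ℚ) - d) / ((q : ℚ) - p)⌉).toNat) :
    Ideal.span {M | ∃ (f : Fin t → Fin m) (g : Fin t → Fin n),
        StrictMono f ∧ StrictMono g ∧
        MvPolynomial.weightedTotalDegree (wt m n a p q)
          (((genMat k m n).submatrix f g).det) ≤ d ∧
        M = ((genMat k m n).submatrix f g).det} =
    Ideal.span {M | ∃ (f : Fin t → Fin m) (g : Fin t → Fin n),
        StrictMono f ∧ StrictMono g ∧
        M = ((genMat k m n).submatrix f g).det} ⊓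
    Ideal.span {M | ∃ (f : Fin r → Fin m) (g : Fin r → Fin n),
        StrictMono f ∧ StrictMono g ∧ (∀ i, (g i : ℕ) < a) ∧
        M = ((genMat k m n).submatrix f g).det} := by
  have hrt : r ≤ t := (le_iff_degree_le hpq le_rfl hr).2 (by simpa using hd)
  have hdeg : ∀ (f : Fin t → Fin m) (g : Fin t → Fin n), StrictMono f → StrictMono g →
      (MvPolynomial.weightedTotalDegree (wt m n a p q) (((genMat k m n).submatrix f g).det) ≤ d ↔
        r ≤ numBelow a g) := fun f g hf hg => by
    rw [weightedTotalDegree_minor k hf.injective hg.injective,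
      le_iff_degree_le hpq (numBelow_le a g) hr]
  refine le_antisymm (Ideal.span_le.2 ?_) ?_
  · rintro _ ⟨f, g, hf, hg, h, rfl⟩
    rw [hdeg f g hf hg] at h
    refine ⟨Ideal.subset_span ⟨f, g, hf, hg, rfl⟩, ?_⟩
    refine Ideal.span_mono ?_ (det_mem_span_minors hrt ((genMat k m n).submatrix f g))
    rintro _ ⟨f', hf', rfl⟩
    exact ⟨f ∘ f', g ∘ Fin.castLE hrt, hf.comp hf', hg.comp (Fin.strictMono_castLE hrt),
      fun i => lt_of_lt_numBelow hg (i.2.trans_le h), rfl⟩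
  · have h₁ : Ideal.span {M | ∃ (f : Fin t → Fin m) (g : Fin t → Fin n),
        StrictMono f ∧ StrictMono g ∧ M = ((genMat k m n).submatrix f g).det} ≤
        Ideal.span {y | ∃ c : ColSeq m (n + m), t ≤ numBelow n c.1 ∧
          y = bracket (extMat k m n) c.1} := by
      refine le_trans (Ideal.span_mono ?_) (span_minors_le_span_bracket k n t)
      rintro _ ⟨f, g, hf, hg, rfl⟩
      exact ⟨f, g, hf, hg, fun i => (g i).2, rfl⟩
    refine (inf_le_inf h₁ (span_minors_le_span_bracket k a r)).trans ?_
    refine (span_bracket_inf_le k (fun c c' h hc => hc.trans (numBelow_anti n h))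
      (fun c c' h hc => hc.trans (numBelow_anti a h))).trans (Ideal.span_le.2 ?_)
    rintro _ ⟨c, ⟨hn, ha⟩, rfl⟩
    refine Ideal.span_mono ?_ (bracket_extMat_mem k hrt c hn ha)
    rintro _ ⟨f, g, hf, hg, h, rfl⟩
    exact ⟨f, g, hf, hg, (hdeg f g hf hg).2 h, rfl⟩
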